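/- The eigenfunction φ₂ decays at rate k₂: there is a constant C > 0 with |φ₂(x)| ≤ C e^{-k₂|x|} for all real x, and there are constants c > 0 and R > 0 such that |φ₂(x)| ≥ c e^{-k₂|x|} whenever |x| ≥ R. -/

import Mathlib

open Real

/-- The soliton `Q(x) = ((p+1)/2)^{1/(p-1)} (sech(βx))^{2/(p-1)}` with `β = (p-1)/2`,
where `sech t = 1 / cosh t`. -/
noncomputable def solitonQ (p : ℝ) : ℝ → ℝ :=
  fun x => ((p + 1) / 2) ^ (1 / (p - 1)) * ((Real.cosh ((p - 1) / 2 * x))⁻¹) ^ (2 / (p - 1))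

/-- The operator `(S_j* g)(x) = -g'(x) - k tanh(βx) g(x)` with `β = (p-1)/2`,
for a constant `k`. -/
noncomputable def Sstar (p k : ℝ) (g : ℝ → ℝ) : ℝ → ℝ :=
  fun x => -(deriv g x) - k * Real.tanh ((p - 1) / 2 * x) * g x

/-- `φ₂ = S₀*(S₁*(Q^{k₂}))` where `k₀ = (p+1)/2`, `k₁ = 1`, `k₂ = (3-p)/2`. -/
noncomputable def phi2 (p : ℝ) : ℝ → ℝ :=
  Sstar p ((p + 1) / 2) (Sstar p 1 (fun x => solitonQ p x ^ ((3 - p) / 2)))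

theorem solitonQ_pos {p : ℝ} (hp : 1 < p) (x : ℝ) : 0 < solitonQ p x := by
  have := Real.cosh_pos ((p - 1) / 2 * x)
  unfold solitonQ
  positivity

theorem solitonQ_rpow {p : ℝ} (hp : 1 < p) (k x : ℝ) :
    solitonQ p x ^ k =
      ((p + 1) / 2) ^ (1 / (p - 1) * k) * Real.cosh ((p - 1) / 2 * x) ^ (-(2 / (p - 1) * k)) := by
  have hc := Real.cosh_pos ((p - 1) / 2 * x)
  have hp' : 0 < (p + 1) / 2 := by linarith
  unfold solitonQ
  rw [Real.mul_rpow (by positivity) (by positivity), ← Real.rpow_mul hp'.le,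
    ← Real.rpow_mul (by positivity), Real.inv_rpow hc.le, Real.rpow_neg hc.le]

theorem hasDerivAt_tanh_const_mul (b x : ℝ) :
    HasDerivAt (fun y => Real.tanh (b * y)) (b * (1 - Real.tanh (b * x) ^ 2)) x := by
  have hc := (Real.cosh_pos (b * x)).ne'
  have hb : HasDerivAt (fun y : ℝ => b * y) b x := by simpa using (hasDerivAt_id x).const_mul b
  have h := hb.sinh.div hb.cosh hc
  simp only [Real.tanh_eq_sinh_div_cosh]
  refine h.congr_deriv ?_
  field_simp

theorem hasDerivAt_solitonQ_rpow {p : ℝ} (hp : 1 < p) (k x : ℝ) :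
    HasDerivAt (fun y => solitonQ p y ^ k)
      (-k * Real.tanh ((p - 1) / 2 * x) * solitonQ p x ^ k) x := by
  have hc := Real.cosh_pos ((p - 1) / 2 * x)
  have hp0 : p - 1 ≠ 0 := by linarith
  have hb : HasDerivAt (fun y : ℝ => (p - 1) / 2 * y) ((p - 1) / 2) x := by
    simpa using (hasDerivAt_id x).const_mul ((p - 1) / 2)
  simp only [solitonQ_rpow hp]
  refine ((hb.cosh.rpow_const (p := -(2 / (p - 1) * k)) (Or.inl hc.ne')).const_mul
    (((p + 1) / 2) ^ (1 / (p - 1) * k))).congr_deriv ?_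
  rw [Real.rpow_sub_one hc.ne', Real.tanh_eq_sinh_div_cosh]
  field_simp

theorem Sstar_solitonQ_rpow {p : ℝ} (hp : 1 < p) (j k : ℝ) :
    Sstar p j (fun x => solitonQ p x ^ k) =
      fun x => (k - j) * (Real.tanh ((p - 1) / 2 * x) * solitonQ p x ^ k) := by
  funext x
  rw [Sstar, (hasDerivAt_solitonQ_rpow hp k x).deriv]
  ring

theorem phi2_eq {p : ℝ} (hp : 1 < p) (x : ℝ) :
    phi2 p x = ((p - 1) / 2) ^ 2 * (1 + Real.tanh ((p - 1) / 2 * x) ^ 2) *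
      solitonQ p x ^ ((3 - p) / 2) := by
  rw [phi2, Sstar_solitonQ_rpow hp, Sstar,
    (((hasDerivAt_tanh_const_mul ((p - 1) / 2) x).fun_mul
      (hasDerivAt_solitonQ_rpow hp ((3 - p) / 2) x)).const_mul _).deriv]
  ring

theorem cosh_le_exp_abs (y : ℝ) : Real.cosh y ≤ Real.exp |y| := by
  rw [← Real.cosh_abs, Real.cosh_eq]
  have : Real.exp (-|y|) ≤ Real.exp |y| := Real.exp_le_exp.2 (by linarith [abs_nonneg y])
  linarith

theorem exp_abs_div_two_le_cosh (y : ℝ) : Real.exp |y| / 2 ≤ Real.cosh y := by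
  rw [← Real.cosh_abs, Real.cosh_eq]
  linarith [Real.exp_pos (-|y|)]

theorem exp_abs_rpow_neg {p : ℝ} (hp : 1 < p) (k x : ℝ) :
    Real.exp |(p - 1) / 2 * x| ^ (-(2 / (p - 1) * k)) = Real.exp (-k * |x|) := by
  have hp0 : p - 1 ≠ 0 := by linarith
  rw [← Real.exp_mul, abs_mul, abs_of_pos (by linarith : 0 < (p - 1) / 2)]
  congr 1
  field_simp

theorem le_solitonQ_rpow {p k : ℝ} (hp : 1 < p) (hk : 0 ≤ k) (x : ℝ) :
    ((p + 1) / 2) ^ (1 / (p - 1) * k) * Real.exp (-k * |x|) ≤ solitonQ p x ^ k := by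
  have hp0 : 0 < p - 1 := by linarith
  rw [solitonQ_rpow hp, ← exp_abs_rpow_neg hp]
  gcongr ?_ * ?_
  exact Real.rpow_le_rpow_of_nonpos (Real.cosh_pos _) (cosh_le_exp_abs _)
    (neg_nonpos.2 (by positivity))

theorem solitonQ_rpow_le {p k : ℝ} (hp : 1 < p) (hk : 0 ≤ k) (x : ℝ) :
    solitonQ p x ^ k ≤ ((p + 1) / 2) ^ (1 / (p - 1) * k) * 2 ^ (2 / (p - 1) * k) *
      Real.exp (-k * |x|) := by
  have hp0 : 0 < p - 1 := by linarith
  rw [solitonQ_rpow hp, ← exp_abs_rpow_neg hp, mul_assoc]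
  gcongr ?_ * ?_
  refine (Real.rpow_le_rpow_of_nonpos (by positivity) (exp_abs_div_two_le_cosh _)
    (neg_nonpos.2 (by positivity))).trans_eq ?_
  rw [Real.div_rpow (by positivity) (by positivity), Real.rpow_neg zero_le_two, div_inv_eq_mul,
    mul_comm]

theorem stmt4 (p : ℝ) (hp1 : 1 < p) (hp3 : p < 3) :
    (∃ C > (0 : ℝ), ∀ x : ℝ, |phi2 p x| ≤ C * Real.exp (-((3 - p) / 2) * |x|)) ∧
      ∃ c > (0 : ℝ), ∃ R > (0 : ℝ), ∀ x : ℝ, R ≤ |x| →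
        c * Real.exp (-((3 - p) / 2) * |x|) ≤ |phi2 p x| := by
  have hβ : 0 < (p - 1) / 2 := by linarith
  have hk : 0 ≤ (3 - p) / 2 := by linarith
  have hA : 0 < ((p + 1) / 2) ^ (1 / (p - 1) * ((3 - p) / 2)) :=
    Real.rpow_pos_of_pos (by linarith) _
  have habs (x : ℝ) : |phi2 p x| = ((p - 1) / 2) ^ 2 * (1 + Real.tanh ((p - 1) / 2 * x) ^ 2) *
      solitonQ p x ^ ((3 - p) / 2) := by
    have := solitonQ_pos hp1 x
    rw [phi2_eq hp1, abs_of_nonneg (by positivity)]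
  refine ⟨⟨((p - 1) / 2) ^ 2 * 2 * (((p + 1) / 2) ^ (1 / (p - 1) * ((3 - p) / 2)) *
      2 ^ (2 / (p - 1) * ((3 - p) / 2))), by positivity, fun x => ?_⟩,
    ((p - 1) / 2) ^ 2 * ((p + 1) / 2) ^ (1 / (p - 1) * ((3 - p) / 2)), by positivity,
    1, one_pos, fun x _ => ?_⟩
  · have hQ := solitonQ_pos hp1 x
    rw [habs, mul_assoc _ _ (Real.exp _)]
    gcongr ((p - 1) / 2) ^ 2 * ?_ * ?_
    · linarith [Real.tanh_sq_lt_one ((p - 1) / 2 * x)]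
    · exact solitonQ_rpow_le hp1 hk x
  · have hQ := solitonQ_pos hp1 x
    rw [habs, mul_assoc _ _ (Real.exp _)]
    gcongr ?_ * ?_
    · exact le_mul_of_one_le_right (by positivity) (le_add_of_nonneg_right (sq_nonneg _))
    · exact le_solitonQ_rpow hp1 hk x
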